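/- arXiv:1704.00971 — 2 statements merged into one kernel-verified Lean document; each statement's English description precedes it below -/
import Mathlib

section
/- Fix 0<α<1. Let m:(0,∞)→[0,1] be measurable with m(r) = α for almost every r ≥ 1/2 and with Q_α(m(r)dr) < ∞. Then the supremum over H ∈ C¹_K((0,∞)) of { −∫₀^∞ H'(r) m(r) dr − ∫₀^∞ σ(m(r)) H(r)² dr } equals the supremum of the same expression taken only over H ∈ C¹_K((0,1/2)); moreover m has a generalized derivative m' on (0,∞), m' = 0 almost everywhere on (1/2,∞), and both suprema equal (1/4) ∫₀^{1/2} m'(r)² / (m(r)(1−m(r))) dr. -/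
open MeasureTheory Set Filter
open scoped ENNReal

noncomputable section

/-- `G` is continuously differentiable with compact support contained in `(0, ∞)`. -/
def IsC1K (G : ℝ → ℝ) : Prop :=
  ContDiff ℝ 1 G ∧ HasCompactSupport G ∧ tsupport G ⊆ Set.Ioi 0

/-- `G` is continuously differentiable with compact support contained in `(0, 1/2)`. -/
def IsC1KHalf (G : ℝ → ℝ) : Prop :=
  ContDiff ℝ 1 G ∧ HasCompactSupport G ∧ tsupport G ⊆ Set.Ioo 0 (1/2)

/-- The density `m_α`: equal to `m` on `(0,1/2)` and to `α` on `[1/2,∞)`. -/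
def mAlpha (α : ℝ) (m : ℝ → ℝ) : ℝ → ℝ := fun r => if r < 1/2 then m r else α

/-- The expression inside the supremum defining the energy `Q_α`. -/
def energyAlphaExpr (α : ℝ) (m G : ℝ → ℝ) : ℝ :=
  (- ∫ r in Set.Ioi (0:ℝ), deriv G r * m r)
    - 2 * ∫ r in Set.Ioi (0:ℝ), (mAlpha α m r * (1 - mAlpha α m r)) * (G r) ^ 2

/-- The energy functional `Q_α(m(r)dr)`, with values in `ℝ≥0∞`. -/
def energyAlpha (α : ℝ) (m : ℝ → ℝ) : ℝ≥0∞ :=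
  ⨆ G : {G : ℝ → ℝ // IsC1K G}, ENNReal.ofReal (energyAlphaExpr α m G.1)

/-- The expression `-∫₀^∞ H'(r) m(r) dr - ∫₀^∞ σ(m(r)) H(r)² dr`. -/
def qExpr (m H : ℝ → ℝ) : ℝ :=
  (- ∫ r in Set.Ioi (0:ℝ), deriv H r * m r)
    - ∫ r in Set.Ioi (0:ℝ), (m r * (1 - m r)) * (H r) ^ 2

/-- `C¹` functions with compact support in `U`, as a submodule. -/
def c1kSub (U : Set ℝ) : Submodule ℝ (ℝ → ℝ) where
  carrier := {G | ContDiff ℝ 1 G ∧ HasCompactSupport G ∧ tsupport G ⊆ U}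
  zero_mem' := by
    refine ⟨contDiff_const, HasCompactSupport.zero, ?_⟩
    simp [tsupport, Function.support_zero]
  add_mem' := by
    rintro a b ⟨h1, h2, h3⟩ ⟨k1, k2, k3⟩
    exact ⟨h1.add k1, h2.add k2, (tsupport_add a b).trans (union_subset h3 k3)⟩
  smul_mem' := by
    rintro c a ⟨h1, h2, h3⟩
    exact ⟨h1.const_smul c, h2.smul_left (f := fun _ => c),
      (tsupport_smul_subset_right (fun _ => c) a).trans h3⟩

theorem riesz_aux {V E : Type*} [AddCommGroup V] [Module ℝ V] [NormedAddCommGroup E]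
    [InnerProductSpace ℝ E] [CompleteSpace E] (ι : V →ₗ[ℝ] E) (L : V →ₗ[ℝ] ℝ) (C : ℝ)
    (hC : ∀ v, L v - 2 * ‖ι v‖ ^ 2 ≤ C) : ∃ h : E, ∀ v, L v = inner ℝ h (ι v) := by
  have hC0 : 0 ≤ C := by simpa using hC 0
  have hb : ∀ v, |L v| ≤ Real.sqrt (8 * C) * ‖ι v‖ := by
    intro v
    have h1 : ∀ t : ℝ, 0 ≤ (2 * ‖ι v‖ ^ 2) * (t * t) + (- L v) * t + C := by
      intro t
      have := hC (t • v)
      simp only [map_smul, norm_smul, smul_eq_mul, mul_pow, Real.norm_eq_abs, sq_abs] at this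
      nlinarith
    have h2 := discrim_le_zero h1
    unfold discrim at h2
    apply abs_le_of_sq_le_sq _ (by positivity)
    rw [mul_pow, Real.sq_sqrt (by positivity)]
    nlinarith
  obtain ⟨s, hs⟩ := ι.rangeRestrict.exists_rightInverse_of_surjective (by
    exact LinearMap.range_rangeRestrict ι)
  have hs' : ∀ x, ι (s x) = x := fun x => by
    have := LinearMap.congr_fun hs x
    exact congrArg Subtype.val this
  let L' : StrongDual ℝ (LinearMap.range ι) := (L ∘ₗ s).mkContinuous (Real.sqrt (8 * C)) (by
    intro x
    have := hb (s x)
    rw [hs'] at this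
    simpa using this)
  obtain ⟨F, hF, -⟩ := exists_extension_norm_eq _ L'
  refine ⟨(InnerProductSpace.toDual ℝ E).symm F, fun v => ?_⟩
  rw [InnerProductSpace.toDual_symm_apply]
  have h1 := hF ⟨ι v, LinearMap.mem_range_self ι v⟩
  simp only at h1
  rw [h1]
  change L v = L (s _)
  have h2 := hb (v - s ⟨ι v, LinearMap.mem_range_self ι v⟩)
  rw [map_sub, map_sub, hs'] at h2
  simp at h2
  linarith

/-- For a density equal to `α` a.e. on `[1/2,∞)` with `Q_α` finite, the supremum of the
energy expression over `C¹_K((0,∞))` coincides with the supremum over `C¹_K((0,1/2))`;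
moreover `m` has a generalized derivative, vanishing a.e. on `(1/2,∞)`, and both suprema
equal `(1/4)∫₀^{1/2} m'(r)²/σ(m(r)) dr`. -/
theorem stmt3 (α : ℝ) (hα0 : 0 < α) (hα1 : α < 1)
    (m : ℝ → ℝ) (hmeas : Measurable m)
    (hm01 : ∀ r ∈ Set.Ioi (0:ℝ), m r ∈ Set.Icc (0:ℝ) 1)
    (hma : ∀ᵐ r ∂(volume.restrict (Set.Ici (1/2 : ℝ))), m r = α)
    (hQ : energyAlpha α m ≠ ⊤) :
    ∃ g : ℝ → ℝ, LocallyIntegrableOn g (Set.Ioi 0) ∧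
      (∀ G : ℝ → ℝ, IsC1K G →
        ∫ r in Set.Ioi (0:ℝ), deriv G r * m r
          = - ∫ r in Set.Ioi (0:ℝ), G r * g r) ∧
      (∀ᵐ r ∂(volume.restrict (Set.Ioi (1/2 : ℝ))), g r = 0) ∧
      (⨆ H : {H : ℝ → ℝ // IsC1K H}, ENNReal.ofReal (qExpr m H.1))
        = (⨆ H : {H : ℝ → ℝ // IsC1KHalf H}, ENNReal.ofReal (qExpr m H.1)) ∧
      IntegrableOn (fun r => (g r) ^ 2 / (m r * (1 - m r))) (Set.Ioo 0 (1/2)) ∧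
      (⨆ H : {H : ℝ → ℝ // IsC1K H}, ENNReal.ofReal (qExpr m H.1))
        = ENNReal.ofReal
            ((1/4) * ∫ r in Set.Ioo (0:ℝ) (1/2),
              (g r) ^ 2 / (m r * (1 - m r))) := by
  classical
  have hI0 : MeasurableSet (Ioi (0:ℝ)) := measurableSet_Ioi
  let w : ℝ → NNReal := fun r => (m r * (1 - m r)).toNNReal
  have hw : Measurable w := (hmeas.mul (measurable_const.sub hmeas)).real_toNNReal
  have hw1 : ∀ r, w r ≤ 1 := by
    intro r
    simp only [w]
    rw [Real.toNNReal_le_one]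
    nlinarith [sq_nonneg (m r - 1/2)]
  have hwr : ∀ r ∈ Ioi (0:ℝ), (w r : ℝ) = m r * (1 - m r) := by
    intro r hr
    have := hm01 r hr
    exact Real.coe_toNNReal _ (mul_nonneg this.1 (by linarith [this.2]))
  let μ : Measure ℝ := (volume.restrict (Ioi (0:ℝ))).withDensity (fun r => (w r : ℝ≥0∞))
  have hμle : μ ≤ volume := by
    refine le_trans ?_ (Measure.restrict_le_self (s := Ioi (0:ℝ)))
    calc μ ≤ (volume.restrict (Ioi (0:ℝ))).withDensity 1 := by
          apply withDensity_mono
          filter_upwards with r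
          simpa using hw1 r
      _ = _ := withDensity_one
  have hint : ∀ f : ℝ → ℝ, ∫ r, f r ∂μ = ∫ r in Ioi (0:ℝ), (w r : ℝ) * f r := by
    intro f
    exact integral_withDensity_eq_integral_smul hw f
  have hmem : ∀ v : c1kSub (Ioi 0), MemLp v.1 2 μ := fun v =>
    (v.2.1.continuous.memLp_of_hasCompactSupport (μ := volume) v.2.2.1).mono_measure hμle
  let ι : c1kSub (Ioi 0) →ₗ[ℝ] Lp ℝ 2 μ :=
    { toFun := fun v => (hmem v).toLp
      map_add' := fun a b => rfl
      map_smul' := fun c a => rfl }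
  have hdint : ∀ v : c1kSub (Ioi 0),
      Integrable (fun r => deriv v.1 r * m r) (volume.restrict (Ioi 0)) := by
    intro v
    have h1 : Integrable (deriv v.1) (volume.restrict (Ioi (0:ℝ))) :=
      ((v.2.1.continuous_deriv le_rfl).integrable_of_hasCompactSupport v.2.2.1.deriv).restrict
    refine h1.mul_bdd (c := 1) hmeas.aestronglyMeasurable ?_
    filter_upwards [ae_restrict_mem hI0] with r hr
    have := hm01 r hr
    rw [Real.norm_eq_abs, abs_le]
    constructor <;> linarith [this.1, this.2]
  have hdiff : ∀ v : c1kSub (Ioi 0), Differentiable ℝ v.1 := fun v => v.2.1.differentiable (by simp)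
  let L : c1kSub (Ioi 0) →ₗ[ℝ] ℝ :=
    { toFun := fun v => - ∫ r in Ioi (0:ℝ), deriv v.1 r * m r
      map_add' := by
        intro a b
        rw [← neg_add, ← integral_add (hdint a) (hdint b)]
        congr 2
        ext r
        have : deriv (a + b).1 r = deriv a.1 r + deriv b.1 r :=
          deriv_add (hdiff a r) (hdiff b r)
        rw [this, add_mul]
      map_smul' := by
        intro c a
        rw [RingHom.id_apply, smul_eq_mul, mul_neg, ← integral_const_mul]
        congr 2
        ext r
        have : deriv (c • a).1 r = c * deriv a.1 r :=
          deriv_const_mul c (hdiff a r)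
        rw [this, mul_assoc] }
  have hinner : ∀ (f : Lp ℝ 2 μ) (v : c1kSub (Ioi 0)),
      inner ℝ f (ι v) = ∫ r in Ioi (0:ℝ), (w r : ℝ) * (v.1 r * f r) := by
    intro f v
    rw [L2.inner_def, ← hint]
    apply integral_congr_ae
    filter_upwards [(hmem v).coeFn_toLp] with r hr
    change (inner ℝ (f r) (((hmem v).toLp : Lp ℝ 2 μ) r)) = _
    rw [hr]
    simp
  have hnorm : ∀ v : c1kSub (Ioi 0), ‖ι v‖ ^ 2 = ∫ r in Ioi (0:ℝ), (m r * (1 - m r)) * (v.1 r) ^ 2 := by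
    intro v
    rw [← real_inner_self_eq_norm_sq, L2.inner_def]
    rw [← setIntegral_congr_fun (f := fun r => (w r : ℝ) * (v.1 r) ^ 2) hI0
      (fun r hr => by simp only [hwr r hr]), ← hint]
    apply integral_congr_ae
    filter_upwards [(hmem v).coeFn_toLp] with r hr
    change (inner ℝ (((hmem v).toLp : Lp ℝ 2 μ) r) (((hmem v).toLp : Lp ℝ 2 μ) r)) = _
    rw [hr]
    simp [sq]
  have hmae : ∀ᵐ r ∂(volume.restrict (Ioi (0:ℝ))), mAlpha α m r = m r := by
    rw [ae_restrict_iff' measurableSet_Ici] at hma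
    filter_upwards [ae_restrict_of_ae hma] with r hr
    unfold mAlpha
    split_ifs with h
    · rfl
    · exact (hr (not_lt.mp h)).symm
  have hE : ∀ v : c1kSub (Ioi 0), energyAlphaExpr α m v.1 = L v - 2 * ‖ι v‖ ^ 2 := by
    intro v
    rw [hnorm]
    unfold energyAlphaExpr
    congr 2
    apply integral_congr_ae
    filter_upwards [hmae] with r hr
    rw [hr]
  have hq : ∀ v : c1kSub (Ioi 0), qExpr m v.1 = L v - ‖ι v‖ ^ 2 := by
    intro v
    rw [hnorm]
    rfl
  obtain ⟨h, hh⟩ := riesz_aux ι L (energyAlpha α m).toReal (by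
    intro v
    rw [← hE]
    rw [← ENNReal.ofReal_le_iff_le_toReal hQ]
    exact le_iSup (fun G : {G : ℝ → ℝ // IsC1K G} =>
      ENNReal.ofReal (energyAlphaExpr α m G.1)) ⟨v.1, v.2⟩)
  have hsm : ∀ f : Lp ℝ 2 μ, Measurable f := fun f => (Lp.stronglyMeasurable f).measurable
  have hsq : ∀ f : Lp ℝ 2 μ, IntegrableOn (fun r => (w r : ℝ) * (f r) ^ 2) (Ioi 0) := by
    intro f
    have := (Lp.memLp f).integrable_sq
    exact (integrable_withDensity_iff_integrable_coe_smul hw).1 this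
  have hloc : ∀ f : Lp ℝ 2 μ, LocallyIntegrableOn (fun r => f r * w r) (Ioi 0) := by
    intro f
    rw [locallyIntegrableOn_iff isOpen_Ioi.isLocallyClosed]
    intro K hK hKc
    have h1 := ((hsq f).mono_set hK).add (integrableOn_const (C := (1:ℝ)) hKc.measure_lt_top.ne)
    refine Integrable.mono' h1
      ((hsm f).mul hw.coe_nnreal_real).aestronglyMeasurable ?_
    filter_upwards with r
    have h0 : (0:ℝ) ≤ w r := (w r).2
    have h1 : (w r : ℝ) ≤ 1 := by exact_mod_cast hw1 r
    rw [Real.norm_eq_abs, abs_mul, abs_of_nonneg h0]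
    simp only [Pi.add_apply]
    rw [← sq_abs (f r)]
    nlinarith [sq_nonneg (|f r| - 1), mul_nonneg h0 (sq_nonneg (|f r| - 1)), mul_nonneg h0 (sq_nonneg (|f r|))]
  have hvan : ∀ (f : Lp ℝ 2 μ) (U : Set ℝ), IsOpen U → U ⊆ Ioi 0 →
      (∀ v : c1kSub (Ioi 0), v.1 ∈ c1kSub U → inner ℝ f (ι v) = 0) →
      ∀ᵐ r, r ∈ U → f r * w r = 0 := by
    intro f U hU hU0 hf
    refine hU.ae_eq_zero_of_integral_contDiff_smul_eq_zero
      ((hloc f).mono_set hU0) ?_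
    intro G hG1 hG2 hG3
    have hGU : G ∈ c1kSub U := ⟨hG1.of_le (by exact_mod_cast le_top), hG2, hG3⟩
    have := hf ⟨G, hGU.1, hG2, hG3.trans hU0⟩ hGU
    rw [hinner] at this
    rw [← this, ← setIntegral_eq_integral_of_forall_compl_eq_zero (s := Ioi (0:ℝ))]
    · congr 1
      ext r
      simp only [smul_eq_mul]
      ring
    · intro r hr
      have : G r = 0 := image_eq_zero_of_notMem_tsupport (fun hc => hr (hU0 (hG3 hc)))
      simp [this]
  have hg0 : ∀ᵐ r, r ∈ Ioi (1/2:ℝ) → h r * w r = 0 := by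
    refine hvan h _ isOpen_Ioi (Ioi_subset_Ioi (by norm_num)) ?_
    intro v hv
    rw [← hh]
    change - ∫ r in Ioi (0:ℝ), deriv v.1 r * m r = 0
    have h1 : ∫ r in Ioi (0:ℝ), deriv v.1 r * m r = ∫ r in Ioi (0:ℝ), deriv v.1 r * α := by
      apply integral_congr_ae
      rw [ae_restrict_iff' measurableSet_Ici] at hma
      filter_upwards [ae_restrict_of_ae hma] with r hr
      by_cases h2 : 1/2 ≤ r
      · rw [hr h2]
      · have : deriv v.1 r = 0 := by
          apply deriv_of_notMem_tsupport
          intro hc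
          exact h2 (le_of_lt (hv.2.2 hc))
        rw [this]; simp
    rw [h1, integral_mul_const]
    have h2 : ∫ r in Ioi (0:ℝ), deriv v.1 r = 0 := by
      rw [setIntegral_eq_integral_of_forall_compl_eq_zero]
      · exact integral_eq_zero_of_hasDerivAt_of_integrable
          (fun r => (hdiff v r).hasDerivAt)
          ((v.2.1.continuous_deriv le_rfl).integrable_of_hasCompactSupport v.2.2.1.deriv)
          (v.2.1.continuous.integrable_of_hasCompactSupport v.2.2.1)
      · intro r hr
        exact deriv_of_notMem_tsupport (fun hc => hr (v.2.2.2 hc))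
    rw [h2]; simp
  have hhalf : Ioo (0:ℝ) (1/2) ⊆ Ioi 0 := fun r hr => hr.1
  have hconv : ∀ r ∈ Ioi (0:ℝ), (h r * w r) ^ 2 / (m r * (1 - m r)) = (w r : ℝ) * (h r) ^ 2 := by
    intro r hr
    rw [← hwr r hr]
    by_cases h0 : (w r : ℝ) = 0
    · simp [h0]
    · field_simp
  have hI : ‖h‖ ^ 2 = ∫ r in Ioo (0:ℝ) (1/2), (h r * w r) ^ 2 / (m r * (1 - m r)) := by
    rw [← real_inner_self_eq_norm_sq, L2.inner_def, hint,
      setIntegral_congr_fun measurableSet_Ioo (fun r hr => hconv r (hhalf hr))]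
    have hne : ∀ᵐ r : ℝ, r ≠ 1/2 := by simp [ae_iff]
    rw [← setIntegral_eq_of_subset_of_ae_sdiff_eq_zero hI0.nullMeasurableSet hhalf]
    · simp [sq]
    · filter_upwards [hg0, hne] with r h1 h2 h3
      have h4 : r ∈ Ioi (1/2:ℝ) := by
        have h5 : ¬ (r < 1/2) := fun hc => h3.2 ⟨h3.1, hc⟩
        exact lt_of_le_of_ne (not_lt.mp h5) (Ne.symm h2)
      have := h1 h4
      rw [sq, ← mul_assoc, mul_comm (w r : ℝ), this, zero_mul]
  have hsub : ∀ {H}, IsC1KHalf H → IsC1K H := fun hH => ⟨hH.1, hH.2.1, hH.2.2.trans hhalf⟩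
  have hq2 : ∀ v : c1kSub (Ioi 0), qExpr m v.1 = 1/4 * ‖h‖ ^ 2 - ‖ι v - (1/2 : ℝ) • h‖ ^ 2 := by
    intro v
    rw [hq, hh, norm_sub_sq_real, inner_smul_right, real_inner_comm, norm_smul, mul_pow]
    norm_num
    ring
  have hle1 : (⨆ H : {H : ℝ → ℝ // IsC1KHalf H}, ENNReal.ofReal (qExpr m H.1)) ≤
      ⨆ H : {H : ℝ → ℝ // IsC1K H}, ENNReal.ofReal (qExpr m H.1) :=
    iSup_le fun H => le_iSup (fun H : {H : ℝ → ℝ // IsC1K H} => ENNReal.ofReal (qExpr m H.1))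
      ⟨H.1, hsub H.2⟩
  have hle2 : (⨆ H : {H : ℝ → ℝ // IsC1K H}, ENNReal.ofReal (qExpr m H.1)) ≤
      ENNReal.ofReal (1/4 * ‖h‖ ^ 2) := by
    refine iSup_le fun H => ENNReal.ofReal_le_ofReal ?_
    have := hq2 ⟨H.1, H.2⟩
    simp only at this
    rw [this]
    linarith [sq_nonneg ‖ι ⟨H.1, H.2⟩ - (1/2 : ℝ) • h‖]
  let S : Submodule ℝ (Lp ℝ 2 μ) :=
    ((c1kSub (Ioo 0 (1/2))).comap (c1kSub (Ioi 0)).subtype).map ι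
  have hS : (1/2 : ℝ) • h ∈ S.topologicalClosure := by
    apply Submodule.smul_mem
    rw [← Submodule.orthogonal_orthogonal_eq_closure, Submodule.mem_orthogonal]
    intro f hf
    have h1 : ∀ᵐ r, r ∈ Ioo (0:ℝ) (1/2) → f r * w r = 0 := by
      refine hvan f _ isOpen_Ioo hhalf ?_
      intro v hv
      rw [real_inner_comm]
      exact hf _ (Submodule.mem_map_of_mem hv)
    rw [L2.inner_def, hint]
    have hne : ∀ᵐ r : ℝ, r ≠ 1/2 := by simp [ae_iff]
    apply integral_eq_zero_of_ae
    filter_upwards [ae_restrict_mem hI0, ae_restrict_of_ae h1, ae_restrict_of_ae hg0,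
      ae_restrict_of_ae hne] with r h2 h3 h4 h5
    have h6 : (inner ℝ (f r) (h r) : ℝ) = f r * h r := by simp [mul_comm]
    change (w r : ℝ) * inner ℝ (f r) (h r) = 0
    rw [h6]
    rcases lt_or_gt_of_ne h5 with h7 | h7
    · linear_combination (h r) * h3 ⟨h2, h7⟩
    · linear_combination (f r) * h4 h7
  have hle3 : ENNReal.ofReal (1/4 * ‖h‖ ^ 2) ≤
      ⨆ H : {H : ℝ → ℝ // IsC1KHalf H}, ENNReal.ofReal (qExpr m H.1) := by
    have hS' : (1/2 : ℝ) • h ∈ closure (S : Set (Lp ℝ 2 μ)) := hS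
    obtain ⟨x, hx, hlim⟩ := mem_closure_iff_seq_limit.1 hS'
    have h1 : Tendsto (fun n => ENNReal.ofReal (1/4 * ‖h‖ ^ 2 - ‖x n - (1/2 : ℝ) • h‖ ^ 2)) atTop
        (nhds (ENNReal.ofReal (1/4 * ‖h‖ ^ 2 - ‖(1/2 : ℝ) • h - (1/2 : ℝ) • h‖ ^ 2))) :=
      ENNReal.tendsto_ofReal (tendsto_const_nhds.sub (((hlim.sub_const _).norm).pow 2))
    rw [sub_self, norm_zero, zero_pow two_ne_zero, sub_zero] at h1
    refine le_of_tendsto' h1 fun n => ?_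
    obtain ⟨v, hv, hvx⟩ := hx n
    rw [← hvx, ← hq2]
    exact le_iSup (fun H : {H : ℝ → ℝ // IsC1KHalf H} => ENNReal.ofReal (qExpr m H.1))
      ⟨v.1, hv⟩
  refine ⟨fun r => h r * w r, hloc h, ?_, ?_, ?_, ?_, ?_⟩
  · intro G hG
    have h1 := hh ⟨G, hG⟩
    rw [hinner] at h1
    change - ∫ r in Ioi (0:ℝ), deriv G r * m r = _ at h1
    rw [← neg_eq_iff_eq_neg, h1]
    congr 1
    ext r
    ring
  · rw [ae_restrict_iff' measurableSet_Ioi]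
    exact hg0
  · exact le_antisymm (hle2.trans hle3) hle1
  · exact ((hsq h).mono_set hhalf).congr_fun (fun r hr => (hconv r (hhalf hr)).symm)
      measurableSet_Ioo
  · rw [← hI]
    exact le_antisymm hle2 (hle3.trans hle1)
end
end

section
/- Fix 0<α<1. Let m:(0,∞)→[0,1] be measurable with m(r) = α for almost every r > 1/2 and with Q(m(r)dr) < ∞. Then there exists a sequence of twice continuously differentiable functions γₙ:(0,∞)→(0,1), each bounded away from 0 and 1, with γₙ' compactly supported in (0,1/2) and γₙ(r) = α for r ≥ 1/2, such that ∫₀^∞ G(r) γₙ(r) dr → ∫₀^∞ G(r) m(r) dr for every continuous compactly supported G:(0,∞)→ℝ, and Q(γₙ(r)dr) → Q(m(r)dr). -/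
open MeasureTheory Set Filter
open scoped ENNReal

noncomputable section

/-- The expression inside the supremum defining the energy. -/
def energyExpr (m G : ℝ → ℝ) : ℝ :=
  (- ∫ r in Set.Ioi (0:ℝ), deriv G r * m r)
    - ∫ r in Set.Ioi (0:ℝ), (m r * (1 - m r)) * (G r) ^ 2

/-- The energy functional `Q(m(r)dr)`, with values in `ℝ≥0∞`. -/
def energy (m : ℝ → ℝ) : ℝ≥0∞ :=
  ⨆ G : {G : ℝ → ℝ // IsC1K G}, ENNReal.ofReal (energyExpr m G.1)

lemma IsC1K.zero_off {G : ℝ → ℝ} (hG : IsC1K G) {r : ℝ} (hr : r ∉ Set.Ioi (0:ℝ)) :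
    G r = 0 := image_eq_zero_of_notMem_tsupport (fun h => hr (hG.2.2 h))

lemma IsC1K.deriv_zero_off {G : ℝ → ℝ} (hG : IsC1K G) {r : ℝ} (hr : r ∉ Set.Ioi (0:ℝ)) :
    deriv G r = 0 := by
  by_contra h
  exact hr (hG.2.2 (support_deriv_subset h))

lemma IsC1K.cont {G : ℝ → ℝ} (hG : IsC1K G) : Continuous G := hG.1.continuous

lemma IsC1K.cont_deriv {G : ℝ → ℝ} (hG : IsC1K G) : Continuous (deriv G) :=
  hG.1.continuous_deriv (by norm_num)

lemma energyExpr_full (m : ℝ → ℝ) {G : ℝ → ℝ} (hG : IsC1K G) :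
    energyExpr m G = (- ∫ r, deriv G r * m r) - ∫ r, (m r * (1 - m r)) * (G r) ^ 2 := by
  unfold energyExpr
  rw [setIntegral_eq_integral_of_forall_compl_eq_zero,
    setIntegral_eq_integral_of_forall_compl_eq_zero]
  · intro r hr; rw [hG.zero_off hr]; ring
  · intro r hr; rw [hG.deriv_zero_off hr]; ring

lemma le_energy {m G : ℝ → ℝ} (hQ : energy m ≠ ⊤) (hG : IsC1K G) :
    energyExpr m G ≤ (energy m).toReal := by
  refine (ENNReal.ofReal_le_iff_le_toReal hQ).1 ?_
  exact le_iSup (fun G : {G : ℝ → ℝ // IsC1K G} => ENNReal.ofReal (energyExpr m G.1)) ⟨G, hG⟩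

lemma energy_le {m w : ℝ → ℝ} (hQ : energy m ≠ ⊤)
    (h : ∀ G, IsC1K G → energyExpr w G ≤ (energy m).toReal) : energy w ≤ energy m :=
  iSup_le fun G => (ENNReal.ofReal_le_iff_le_toReal hQ).2 (h G.1 G.2)

lemma IsC1K.shift {G : ℝ → ℝ} (hG : IsC1K G) {u : ℝ} (hu : u < 0) :
    IsC1K (fun r => G (r + u)) := by
  refine ⟨hG.1.comp (contDiff_id.add contDiff_const), ?_, ?_⟩
  · exact hG.2.1.comp_homeomorph (Homeomorph.addRight u)
  · have h : tsupport (fun r => G (r + u)) ⊆ (fun r => r + u) ⁻¹' (tsupport G) := by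
      apply closure_minimal
      · intro r hr
        exact subset_tsupport G hr
      · exact (isClosed_tsupport G).preimage (by fun_prop)
    intro r hr
    have := hG.2.2 (h hr)
    simp only [mem_Ioi] at this ⊢
    linarith

lemma energyExpr_shift {M G : ℝ → ℝ} (hQ : energy M ≠ ⊤) (hG : IsC1K G) {u : ℝ} (hu : u < 0) :
    (- ∫ r, deriv G r * M (r - u)) - ∫ r, (M (r - u) * (1 - M (r - u))) * (G r) ^ 2
      ≤ (energy M).toReal := by
  have h := le_energy hQ (hG.shift hu)
  rw [energyExpr_full _ (hG.shift hu)] at h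
  rw [← integral_sub_right_eq_self (fun r => deriv (fun r => G (r + u)) r * M r) u,
    ← integral_sub_right_eq_self (fun r => M r * (1 - M r) * G (r + u) ^ 2) u] at h
  simpa [deriv_comp_add_const] using h

lemma sq_bound {x y : ℝ} (hx : x ∈ Icc (0:ℝ) 1) (hy : y ∈ Icc (0:ℝ) 1) :
    |x * (1 - x) - y * (1 - y)| ≤ |x - y| := by
  have : x * (1 - x) - y * (1 - y) = (x - y) * (1 - x - y) := by ring
  rw [this, abs_mul]
  have h2 : |1 - x - y| ≤ 1 := by
    rw [abs_le]; constructor <;> linarith [hx.1, hx.2, hy.1, hy.2]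
  nlinarith [abs_nonneg (x - y)]

lemma sig_mem {x : ℝ} (hx : x ∈ Icc (0:ℝ) 1) : x * (1 - x) ∈ Icc (0:ℝ) 1 :=
  ⟨mul_nonneg hx.1 (by linarith [hx.2]), by nlinarith [hx.1, hx.2]⟩

lemma integrable_mul_unit {μ : Measure ℝ} {F h : ℝ → ℝ} (hF : Integrable F μ) (hh : Measurable h)
    (h1 : ∀ r, h r ∈ Icc (0:ℝ) 1) : Integrable (fun r => F r * h r) μ := by
  refine hF.mul_bdd (c := 1) hh.aestronglyMeasurable (Eventually.of_forall fun r => ?_)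
  rw [Real.norm_eq_abs, abs_le]
  constructor <;> linarith [(h1 r).1, (h1 r).2]

/-- Basic L1 estimate. -/
lemma diff_bound {F h k a : ℝ → ℝ} {C : ℝ} (hF : Integrable F) (hC : ∀ r, |F r| ≤ C)
    (hh : Measurable h) (h1 : ∀ r, h r ∈ Icc (0:ℝ) 1)
    (hk : Measurable k) (k1 : ∀ r, k r ∈ Icc (0:ℝ) 1)
    (ha : IntegrableOn a (Ioc 0 1))
    (hle : ∀ r, |h r - k r| ≤ a r)
    (heq : ∀ r, 1 < r → h r = k r) :
    |(∫ r in Ioi (0:ℝ), F r * h r) - ∫ r in Ioi (0:ℝ), F r * k r| ≤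
      C * ∫ r in Ioc (0:ℝ) 1, a r := by
  rw [← integral_sub (integrable_mul_unit hF.integrableOn hh h1)
    (integrable_mul_unit hF.integrableOn hk k1)]
  have : ∫ r in Ioi (0:ℝ), (F r * h r - F r * k r) =
      ∫ r in Ioc (0:ℝ) 1, (F r * h r - F r * k r) := by
    apply setIntegral_eq_of_subset_of_forall_sdiff_eq_zero measurableSet_Ioi
    · exact fun x hx => hx.1
    · intro x hx
      have : 1 < x := by
        by_contra h; exact hx.2 ⟨hx.1, not_lt.1 h⟩
      rw [heq x this]; ring
  rw [this, ← integral_const_mul, ← Real.norm_eq_abs]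
  apply norm_integral_le_of_norm_le (ha.const_mul C)
  refine Eventually.of_forall fun r => ?_
  rw [← mul_sub, Real.norm_eq_abs, abs_mul]
  have := hle r
  have := hC r
  gcongr
  exact (abs_nonneg _).trans this

lemma exists_bdd {F : ℝ → ℝ} (hF : Continuous F) (hc : HasCompactSupport F) :
    ∃ C, ∀ r, |F r| ≤ C := hc.exists_bound_of_continuous hF

lemma abs_diff_integrableOn {h k : ℝ → ℝ} (hh : Measurable h) (h1 : ∀ r, h r ∈ Icc (0:ℝ) 1)
    (hk : Measurable k) (k1 : ∀ r, k r ∈ Icc (0:ℝ) 1) :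
    IntegrableOn (fun r => |h r - k r|) (Ioc 0 1) := by
  refine IntegrableOn.of_bound (by simp) (C := 1)
    (hh.sub hk).abs.aestronglyMeasurable (Eventually.of_forall fun r => ?_)
  rw [Real.norm_eq_abs, abs_abs, abs_le]
  constructor <;> linarith [(h1 r).1, (h1 r).2, (k1 r).1, (k1 r).2]

section limit
variable {M : ℝ → ℝ} {γs : ℕ → ℝ → ℝ}

lemma tendsto_of_L1 (hM : Measurable M) (hM1 : ∀ r, M r ∈ Icc (0:ℝ) 1)
    (hγ : ∀ n, Measurable (γs n)) (hγ1 : ∀ n r, γs n r ∈ Icc (0:ℝ) 1)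
    (heq : ∀ n r, 1 < r → γs n r = M r)
    (hlim : Tendsto (fun n => ∫ r in Ioc (0:ℝ) 1, |γs n r - M r|) atTop (nhds 0))
    {F : ℝ → ℝ} (hF : Continuous F) (hc : HasCompactSupport F) :
    Tendsto (fun n => ∫ r in Ioi (0:ℝ), F r * γs n r) atTop
      (nhds (∫ r in Ioi (0:ℝ), F r * M r)) ∧
    Tendsto (fun n => ∫ r in Ioi (0:ℝ), F r * (γs n r * (1 - γs n r))) atTop
      (nhds (∫ r in Ioi (0:ℝ), F r * (M r * (1 - M r)))) := by
  obtain ⟨C, hC⟩ := exists_bdd hF hc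
  have hFi := hF.integrable_of_hasCompactSupport hc (μ := volume)
  have hlim' : Tendsto (fun n => C * ∫ r in Ioc (0:ℝ) 1, |γs n r - M r|) atTop (nhds 0) := by
    simpa using hlim.const_mul C
  constructor
  · rw [tendsto_iff_dist_tendsto_zero]
    refine squeeze_zero (fun _ => dist_nonneg) (fun n => ?_) hlim'
    exact diff_bound hFi hC (hγ n) (hγ1 n) hM hM1
      (abs_diff_integrableOn (hγ n) (hγ1 n) hM hM1) (fun r => le_rfl) (heq n)
  · rw [tendsto_iff_dist_tendsto_zero]
    refine squeeze_zero (fun _ => dist_nonneg) (fun n => ?_) hlim'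
    exact diff_bound hFi hC ((hγ n).mul (measurable_const.sub (hγ n)))
      (fun r => sig_mem (hγ1 n r)) (hM.mul (measurable_const.sub hM)) (fun r => sig_mem (hM1 r))
      (abs_diff_integrableOn (hγ n) (hγ1 n) hM hM1) (fun r => sq_bound (hγ1 n r) (hM1 r))
      (fun r hr => by rw [heq n r hr])

lemma tendsto_energy (hM : Measurable M) (hM1 : ∀ r, M r ∈ Icc (0:ℝ) 1)
    (hγ : ∀ n, Measurable (γs n)) (hγ1 : ∀ n r, γs n r ∈ Icc (0:ℝ) 1)
    (heq : ∀ n r, 1 < r → γs n r = M r)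
    (hlim : Tendsto (fun n => ∫ r in Ioc (0:ℝ) 1, |γs n r - M r|) atTop (nhds 0))
    (hle : ∀ n, energy (γs n) ≤ energy M) :
    Tendsto (fun n => energy (γs n)) atTop (nhds (energy M)) := by
  rw [tendsto_order]
  constructor
  · intro c hc
    obtain ⟨⟨G, hG⟩, hcG⟩ := lt_iSup_iff.1 hc
    have h1 := (tendsto_of_L1 hM hM1 hγ hγ1 heq hlim hG.cont_deriv hG.2.1.deriv).1
    have h2 := (tendsto_of_L1 hM hM1 hγ hγ1 heq hlim (F := fun r => G r ^ 2)
      (hG.cont.pow 2) (hG.2.1.comp_left (g := fun x => x ^ 2) (by simp))).2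
    have h3 : Tendsto (fun n => ENNReal.ofReal (energyExpr (γs n) G)) atTop
        (nhds (ENNReal.ofReal (energyExpr M G))) := by
      refine ENNReal.tendsto_ofReal ?_
      unfold energyExpr
      have h4 := h1.neg.sub h2
      simpa only [mul_comm (G _ ^ 2)] using h4
    filter_upwards [h3.eventually (lt_mem_nhds hcG)] with n hn
    refine hn.trans_le ?_
    exact le_iSup (fun G : {G : ℝ → ℝ // IsC1K G} => ENNReal.ofReal (energyExpr (γs n) G.1)) ⟨G, hG⟩
  · intro c hc
    exact Eventually.of_forall fun n => (hle n).trans_lt hc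

end limit

lemma swap_lemma {μ : Measure ℝ} [SFinite μ] {F g : ℝ → ℝ} {H : ℝ → ℝ → ℝ}
    (hF : Integrable F μ) (hg : Integrable g) (hH : Measurable (Function.uncurry H))
    (H1 : ∀ x u, H x u ∈ Icc (0:ℝ) 1) :
    Integrable (fun u => g u * ∫ x, F x * H x u ∂μ) ∧
    Integrable (fun x => F x * ∫ u, g u * H x u) μ ∧
    ∫ x, F x * (∫ u, g u * H x u) ∂μ = ∫ u, g u * ∫ x, F x * H x u ∂μ := by
  have hint : Integrable (fun p : ℝ × ℝ => (F p.1 * g p.2) * H p.1 p.2) (μ.prod volume) := by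
    refine (hF.mul_prod hg).mul_bdd (c := 1) hH.aestronglyMeasurable
      (Eventually.of_forall fun p => ?_)
    rw [Real.norm_eq_abs, abs_le]
    have h := H1 p.1 p.2
    change -1 ≤ H p.1 p.2 ∧ H p.1 p.2 ≤ 1
    constructor <;> linarith [h.1, h.2]
  have e1 : ∀ u, g u * ∫ x, F x * H x u ∂μ = ∫ x, (F x * g u) * H x u ∂μ := by
    intro u
    rw [← integral_const_mul]
    congr 1; ext x; ring
  have e2 : ∀ x, F x * ∫ u, g u * H x u = ∫ u, (F x * g u) * H x u := by
    intro u
    rw [← integral_const_mul]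
    congr 1; ext x; ring
  simp_rw [e1, e2]
  exact ⟨hint.integral_prod_right, hint.integral_prod_left, integral_integral_swap hint⟩

section moll
variable {M g : ℝ → ℝ}

/-- The mollification. -/
def moll (g M : ℝ → ℝ) (x : ℝ) : ℝ := ∫ u, g u * M (x - u)

lemma moll_int (hM : Measurable M) (hM1 : ∀ r, M r ∈ Icc (0:ℝ) 1) (hg : Integrable g) (x : ℝ) :
    Integrable (fun u => g u * M (x - u)) :=
  integrable_mul_unit hg (hM.comp (measurable_const.sub measurable_id)) (fun _ => hM1 _)

lemma moll_mem (hM : Measurable M) (hM1 : ∀ r, M r ∈ Icc (0:ℝ) 1) (hg : Integrable g)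
    (hg0 : ∀ u, 0 ≤ g u) (hgi : ∫ u, g u = 1) (x : ℝ) : moll g M x ∈ Icc (0:ℝ) 1 := by
  constructor
  · exact integral_nonneg fun u => mul_nonneg (hg0 u) (hM1 _).1
  · rw [← hgi]
    refine integral_mono (moll_int hM hM1 hg x) hg fun u => ?_
    exact mul_le_of_le_one_right (hg0 u) (hM1 _).2

lemma moll_jensen (hM : Measurable M) (hM1 : ∀ r, M r ∈ Icc (0:ℝ) 1) (hg : Integrable g)
    (hg0 : ∀ u, 0 ≤ g u) (hgi : ∫ u, g u = 1) (x : ℝ) :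
    ∫ u, g u * (M (x - u) * (1 - M (x - u))) ≤ moll g M x * (1 - moll g M x) := by
  set c := moll g M x with hc
  have h1 := moll_int hM hM1 hg x
  have h2 : Integrable (fun u => g u * (M (x - u) * (1 - M (x - u)))) :=
    integrable_mul_unit hg
      ((hM.comp (measurable_const.sub measurable_id)).mul
        (measurable_const.sub (hM.comp (measurable_const.sub measurable_id))))
      (fun _ => sig_mem (hM1 _))
  have h3 : ∫ u, g u * (M (x - u) * (1 - M (x - u))) ≤
      ∫ u, ((1 - 2 * c) * (g u * M (x - u)) + c ^ 2 * g u) := by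
    refine integral_mono h2 ((h1.const_mul _).add (hg.const_mul _)) fun u => ?_
    have := mul_nonneg (hg0 u) (sq_nonneg (M (x - u) - c))
    simp only
    nlinarith
  rw [integral_add (h1.const_mul _) (hg.const_mul _), integral_const_mul, integral_const_mul,
    hgi] at h3
  change _ ≤ (1 - 2 * c) * c + c ^ 2 * 1 at h3
  linarith

lemma moll_contDiff (hM : Measurable M) (hM1 : ∀ r, M r ∈ Icc (0:ℝ) 1)
    (hg : ContDiff ℝ 2 g) (hc : HasCompactSupport g) : ContDiff ℝ 2 (moll g M) := by
  have hloc : LocallyIntegrable M := by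
    have : LocallyIntegrable (fun _ : ℝ => (1:ℝ)) := locallyIntegrable_const 1
    refine this.mono hM.aestronglyMeasurable (Eventually.of_forall fun r => ?_)
    rw [Real.norm_eq_abs, norm_one, abs_le]
    constructor <;> linarith [(hM1 r).1, (hM1 r).2]
  exact hc.contDiff_convolution_left (ContinuousLinearMap.mul ℝ ℝ) hg hloc

lemma moll_energy (hM : Measurable M) (hM1 : ∀ r, M r ∈ Icc (0:ℝ) 1) (hgc : Continuous g)
    (hcs : HasCompactSupport g)
    (hg0 : ∀ u, 0 ≤ g u) (hgi : ∫ u, g u = 1) (hsupp : ∀ u, 0 ≤ u → g u = 0)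
    (hcont : Continuous (moll g M))
    (hQ : energy M ≠ ⊤) {G : ℝ → ℝ} (hG : IsC1K G) :
    energyExpr (moll g M) G ≤ (energy M).toReal := by
  have hg : Integrable g := hgc.integrable_of_hasCompactSupport hcs
  have hG1 : Integrable (deriv G) := hG.cont_deriv.integrable_of_hasCompactSupport hG.2.1.deriv
  have hG2c : HasCompactSupport (fun r => G r ^ 2) :=
    hG.2.1.comp_left (g := fun x => x ^ 2) (by simp)
  have hG2 : Integrable (fun r => G r ^ 2) :=
    (hG.cont.pow 2).integrable_of_hasCompactSupport hG2c
  have mH : Measurable (Function.uncurry (fun x u : ℝ => M (x - u))) :=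
    hM.comp (measurable_fst.sub measurable_snd)
  obtain ⟨a1, _, a3⟩ := swap_lemma (H := fun x u => M (x - u)) hG1 hg mH (fun _ _ => hM1 _)
  obtain ⟨b1, b2, b3⟩ := swap_lemma (H := fun x u => M (x - u) * (1 - M (x - u))) hG2 hg
    (mH.mul (measurable_const.sub mH)) (fun _ _ => sig_mem (hM1 _))
  rw [energyExpr_full _ hG]
  have h2 : ∫ r, G r ^ 2 * (∫ u, g u * (M (r - u) * (1 - M (r - u)))) ≤
      ∫ r, (moll g M r * (1 - moll g M r)) * G r ^ 2 := by
    refine integral_mono b2 ?_ fun r => ?_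
    · exact ((hcont.mul (continuous_const.sub hcont)).mul
        (hG.cont.pow 2)).integrable_of_hasCompactSupport hG2c.mul_left
    · simp only
      rw [mul_comm]
      exact mul_le_mul_of_nonneg_right (moll_jensen hM hM1 hg hg0 hgi r) (sq_nonneg _)
  have h3 : (- ∫ u, g u * ∫ x, deriv G x * M (x - u)) -
      (∫ u, g u * ∫ x, G x ^ 2 * (M (x - u) * (1 - M (x - u)))) ≤ (energy M).toReal := by
    have a1n : Integrable (fun u => -(g u * ∫ x, deriv G x * M (x - u))) := a1.neg
    rw [← integral_neg, ← integral_sub a1n b1]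
    have : (energy M).toReal = ∫ u, g u * (energy M).toReal := by
      rw [integral_mul_const, hgi, one_mul]
    rw [this]
    refine integral_mono (a1n.sub b1) (hg.mul_const _) fun u => ?_
    simp only
    rcases le_or_gt 0 u with hu | hu
    · simp [hsupp u hu]
    · have := mul_le_mul_of_nonneg_left (energyExpr_shift hQ hG hu) (hg0 u)
      simp only [mul_comm (G _ ^ 2)]
      linarith
  have h4 : ∫ r, deriv G r * moll g M r = ∫ x, deriv G x * ∫ u, g u * M (x - u) := rfl
  rw [h4, a3]
  linarith

lemma moll_L1 (hM : Measurable M) (hM1 : ∀ r, M r ∈ Icc (0:ℝ) 1) (hg : Integrable g)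
    (hcont : Measurable (moll g M))
    (hg0 : ∀ u, 0 ≤ g u) (hgi : ∫ u, g u = 1) {ε δ : ℝ} (hsupp : ∀ u, δ ≤ |u| → g u = 0)
    (hd : ∀ u, |u| < δ → ∫ x in Ioc (0:ℝ) 1, |M (x - u) - M x| ≤ ε) :
    ∫ x in Ioc (0:ℝ) 1, |moll g M x - M x| ≤ ε := by
  have mH : Measurable (Function.uncurry (fun x u : ℝ => |M (x - u) - M x|)) :=
    ((hM.comp (measurable_fst.sub measurable_snd)).sub (hM.comp measurable_fst)).abs
  have H1 : ∀ x u, |M (x - u) - M x| ∈ Icc (0:ℝ) 1 := fun x u => by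
    refine ⟨abs_nonneg _, ?_⟩
    rw [abs_le]
    constructor <;> linarith [(hM1 x).1, (hM1 x).2, (hM1 (x - u)).1, (hM1 (x - u)).2]
  obtain ⟨a1, a2, a3⟩ := swap_lemma (μ := volume.restrict (Ioc (0:ℝ) 1)) (F := fun _ => 1)
    (H := fun x u => |M (x - u) - M x|) (integrable_const 1) hg mH H1
  simp only [one_mul] at a1 a2 a3
  calc _ ≤ ∫ x in Ioc (0:ℝ) 1, ∫ u, g u * |M (x - u) - M x| := by
        refine integral_mono (abs_diff_integrableOn hcont (moll_mem hM hM1 hg hg0 hgi) hM hM1) a2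
          fun x => ?_
        have e : moll g M x - M x = ∫ u, g u * (M (x - u) - M x) := by
          simp_rw [mul_sub]
          rw [integral_sub (moll_int hM hM1 hg x) (hg.mul_const _), integral_mul_const, hgi,
            one_mul]
          rfl
        simp only
        rw [e]
        refine (abs_integral_le_integral_abs).trans (le_of_eq ?_)
        congr 1; ext u; rw [abs_mul, abs_of_nonneg (hg0 u)]
    _ = _ := a3
    _ ≤ ∫ u, g u * ε := by
        refine integral_mono a1 (hg.mul_const _) fun u => ?_
        simp only
        rcases le_or_gt δ |u| with hu | hu
        · simp [hsupp u hu]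
        · exact mul_le_mul_of_nonneg_left (hd u hu) (hg0 u)
    _ = ε := by rw [integral_mul_const, hgi, one_mul]

lemma translate_L1 {α : ℝ} (hM : Measurable M) (hM1 : ∀ r, M r ∈ Icc (0:ℝ) 1)
    (hMα : ∀ r, r ∉ Ioc (0:ℝ) 1 → M r = α) {ε : ℝ} (hε : 0 < ε) :
    ∃ δ > 0, ∀ u, |u| < δ → ∫ x in Ioc (0:ℝ) 1, |M (x - u) - M x| ≤ ε := by
  have hN : Integrable (fun x => M x - α) := by
    have : (fun x => M x - α) = (Ioc (0:ℝ) 1).indicator (fun x => M x - α) := by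
      ext x
      by_cases hx : x ∈ Ioc (0:ℝ) 1
      · simp [hx]
      · rw [indicator_of_notMem hx, hMα x hx, sub_self]
    rw [this]
    refine IntegrableOn.integrable_indicator ?_ measurableSet_Ioc
    refine Integrable.sub ?_ (integrable_const _)
    have := integrable_mul_unit (μ := volume.restrict (Ioc (0:ℝ) 1)) (F := fun _ => 1)
      (integrable_const _) hM hM1
    simpa using this
  obtain ⟨k, hkc, hk, hkcont, hki⟩ := hN.exists_hasCompactSupport_integral_sub_le
    (ε := ε / 3) (by positivity)
  have huc := hkc.uniformContinuous_of_continuous hkcont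
  obtain ⟨δ, hδ, hδ'⟩ := Metric.uniformContinuous_iff.1 huc (ε / 3) (by positivity)
  refine ⟨δ, hδ, fun u hu => ?_⟩
  have hI : Integrable (fun x => ‖M x - α - k x‖) := (hN.sub hki).norm
  have hIu : Integrable (fun x => ‖M (x - u) - α - k (x - u)‖) := hI.comp_sub_right u
  have hle : ∀ {f : ℝ → ℝ}, Integrable f → (∀ x, 0 ≤ f x) →
      ∫ x in Ioc (0:ℝ) 1, f x ≤ ∫ x, f x := fun hf h0 =>
    setIntegral_le_integral hf (Eventually.of_forall h0)
  calc ∫ x in Ioc (0:ℝ) 1, |M (x - u) - M x|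
      ≤ ∫ x in Ioc (0:ℝ) 1, (‖M (x - u) - α - k (x - u)‖ + ‖M x - α - k x‖ + ε / 3) := by
        refine integral_mono
          (abs_diff_integrableOn (h := fun x => M (x - u)) (hM.comp (measurable_id.sub_const u)) (fun _ => hM1 _) hM hM1)
          ((hIu.integrableOn.add hI.integrableOn).add (integrable_const _)) fun x => ?_
        have h1 := hδ' (a := x - u) (b := x) (by simpa [Real.dist_eq] using hu)
        rw [Real.dist_eq] at h1
        simp only [Real.norm_eq_abs]
        have : M (x - u) - M x = (M (x - u) - α - k (x - u)) - (M x - α - k x)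
          + (k (x - u) - k x) := by ring
        rw [this]
        refine (abs_add_le _ _).trans ?_
        have := abs_sub (M (x - u) - α - k (x - u)) (M x - α - k x)
        linarith
    _ = (∫ x in Ioc (0:ℝ) 1, ‖M (x - u) - α - k (x - u)‖) +
          (∫ x in Ioc (0:ℝ) 1, ‖M x - α - k x‖) + ε / 3 := by
        have hS : IntegrableOn (fun x => ‖M (x - u) - α - k (x - u)‖ + ‖M x - α - k x‖)
          (Ioc (0:ℝ) 1) := hIu.integrableOn.add hI.integrableOn
        rw [integral_add hS (integrable_const _),
          integral_add hIu.integrableOn hI.integrableOn]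
        simp
    _ ≤ ε / 3 + ε / 3 + ε / 3 := by
        gcongr
        · refine (hle hIu fun _ => norm_nonneg _).trans ?_
          rw [integral_sub_right_eq_self (fun x => ‖M x - α - k x‖) u]
          exact hk
        · exact (hle hI fun _ => norm_nonneg _).trans hk
    _ = ε := by ring

end moll

lemma energyExpr_smooth {w G : ℝ → ℝ} (hw : ContDiff ℝ 1 w) (hG : IsC1K G) :
    Integrable (fun r => G r * deriv w r - (w r * (1 - w r)) * G r ^ 2) ∧
    energyExpr w G = ∫ r, (G r * deriv w r - (w r * (1 - w r)) * G r ^ 2) := by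
  have hwc := hw.continuous
  have hw' : Continuous (deriv w) := hw.continuous_deriv (by norm_num)
  have hG2c : HasCompactSupport (fun r => G r ^ 2) :=
    hG.2.1.comp_left (g := fun x => x ^ 2) (by simp)
  have i1 : Integrable (fun r => G r * deriv w r) :=
    (hG.cont.mul hw').integrable_of_hasCompactSupport hG.2.1.mul_right
  have i2 : Integrable (fun r => deriv G r * w r) :=
    (hG.cont_deriv.mul hwc).integrable_of_hasCompactSupport hG.2.1.deriv.mul_right
  have i3 : Integrable (fun r => G r * w r) :=
    (hG.cont.mul hwc).integrable_of_hasCompactSupport hG.2.1.mul_right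
  have i4 : Integrable (fun r => (w r * (1 - w r)) * G r ^ 2) :=
    ((hwc.mul (continuous_const.sub hwc)).mul
        (hG.cont.pow 2)).integrable_of_hasCompactSupport hG2c.mul_left
  refine ⟨i1.sub i4, ?_⟩
  rw [integral_sub i1 i4, energyExpr_full _ hG]
  have := integral_mul_deriv_eq_deriv_mul_of_integrable (u := G) (v := w) (u' := deriv G)
    (v' := deriv w) (fun x _ => (hG.1.differentiable (by norm_num) x).hasDerivAt)
    (fun x _ => (hw.differentiable (by norm_num) x).hasDerivAt) i1 i2 i3
  rw [this]

lemma mix_energy {w G : ℝ → ℝ} {α e Q : ℝ} (hα0 : 0 ≤ α) (hα1 : α ≤ 1) (he0 : 0 ≤ e) (he1 : e ≤ 1)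
    (hw : ContDiff ℝ 1 w) (hG : IsC1K G) (hQ0 : 0 ≤ Q) (hQ : energyExpr w G ≤ Q) :
    energyExpr (fun r => (1 - e) * w r + e * α) G ≤ Q := by
  have hb : ContDiff ℝ 1 (fun r => (1 - e) * w r + e * α) :=
    (contDiff_const.mul hw).add contDiff_const
  obtain ⟨i1, e1⟩ := energyExpr_smooth hw hG
  obtain ⟨i2, e2⟩ := energyExpr_smooth hb hG
  have hd : ∀ r, deriv (fun r => (1 - e) * w r + e * α) r = (1 - e) * deriv w r := fun r =>
    (((hw.differentiable (by norm_num) r).hasDerivAt.const_mul (1 - e)).add_const _).deriv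
  have h3 : energyExpr (fun r => (1 - e) * w r + e * α) G ≤ (1 - e) * energyExpr w G := by
    rw [e1, e2, ← integral_const_mul]
    refine integral_mono i2 (i1.const_mul _) fun r => ?_
    simp only [hd]
    have h : ((1 - e) * w r + e * α) * (1 - ((1 - e) * w r + e * α)) - (1 - e) * (w r * (1 - w r))
      = e * (α * (1 - α)) + e * (1 - e) * (w r - α) ^ 2 := by ring
    have h0 : 0 ≤ e * (α * (1 - α)) + e * (1 - e) * (w r - α) ^ 2 := by
      have := sub_nonneg.2 he1
      have := sub_nonneg.2 hα1
      positivity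
    have := mul_nonneg (h ▸ h0) (sq_nonneg (G r))
    nlinarith
  nlinarith

/-- Smooth cutoff. -/
def cut (b r : ℝ) : ℝ := Real.smoothTransition ((r - b) / b)

lemma cut_contDiff (b : ℝ) : ContDiff ℝ 2 (cut b) :=
  Real.smoothTransition.contDiff.comp ((contDiff_id.sub contDiff_const).div_const _)

lemma cut_nonneg (b r : ℝ) : 0 ≤ cut b r := Real.smoothTransition.nonneg _
lemma cut_le_one (b r : ℝ) : cut b r ≤ 1 := Real.smoothTransition.le_one _
lemma cut_zero {b r : ℝ} (hb : 0 < b) (h : r ≤ b) : cut b r = 0 :=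
  Real.smoothTransition.zero_of_nonpos (div_nonpos_of_nonpos_of_nonneg (by linarith) hb.le)
lemma cut_one {b r : ℝ} (hb : 0 < b) (h : 2 * b ≤ r) : cut b r = 1 :=
  Real.smoothTransition.one_of_one_le (by rw [le_div_iff₀ hb]; linarith)

/-- Reparametrisation. -/
def theta (b r : ℝ) : ℝ := 2 * b + ∫ s in (0:ℝ)..r, cut b s

lemma theta_hasDeriv (b r : ℝ) : HasDerivAt (theta b) (cut b r) r := by
  have hc := (cut_contDiff b).continuous
  exact (hc.integral_hasStrictDerivAt 0 r).hasDerivAt.const_add (2 * b)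

lemma theta_contDiff (b : ℝ) : ContDiff ℝ 2 (theta b) := by
  rw [show (2 : WithTop ℕ∞) = 1 + 1 by norm_num, contDiff_succ_iff_deriv]
  refine ⟨fun r => (theta_hasDeriv b r).differentiableAt, by simp, ?_⟩
  rw [show deriv (theta b) = cut b from funext fun r => (theta_hasDeriv b r).deriv]
  exact (cut_contDiff b).of_le (by norm_num)

lemma theta_const {b r : ℝ} (hb : 0 < b) (h : r ≤ b) : theta b r = 2 * b := by
  unfold theta
  rw [intervalIntegral.integral_congr (g := fun _ => 0)]
  · simp
  · intro x hx
    refine cut_zero hb ?_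
    have := hx.2
    exact this.trans (max_le hb.le h)

lemma theta_mono {b : ℝ} : Monotone (theta b) :=
  monotone_of_deriv_nonneg (fun r => (theta_hasDeriv b r).differentiableAt) fun r => by
    rw [(theta_hasDeriv b r).deriv]; exact cut_nonneg b r

lemma theta_ge {b : ℝ} (hb : 0 < b) (r : ℝ) : 2 * b ≤ theta b r := by
  rcases le_total r 0 with h | h
  · rw [theta_const hb (h.trans hb.le)]
  · have := theta_mono (b := b) h
    rwa [theta_const hb hb.le] at this

lemma theta_anti {b : ℝ} : Antitone (fun r => theta b r - r) := by
  have hd : ∀ r, HasDerivAt (fun r => theta b r - r) (cut b r - 1) r := fun r =>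
    (theta_hasDeriv b r).sub (hasDerivAt_id r)
  refine antitone_of_deriv_nonpos (fun r => (hd r).differentiableAt) fun r => ?_
  rw [(hd r).deriv]
  linarith [cut_le_one b r]

lemma theta_id {b r : ℝ} (hb : 0 < b) (h : 2 * b ≤ r) : theta b r - r = theta b (2 * b) - 2 * b := by
  have e : ∫ s in (0:ℝ)..r, cut b s =
      (∫ s in (0:ℝ)..(2 * b), cut b s) + ∫ s in (2 * b)..r, cut b s := by
    have hc := (cut_contDiff b).continuous
    rw [intervalIntegral.integral_add_adjacent_intervals] <;> exact hc.intervalIntegrable _ _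
  have e2 : ∫ s in (2 * b)..r, cut b s = r - 2 * b := by
    rw [intervalIntegral.integral_congr (g := fun _ => 1)]
    · simp
    · intro x hx
      rw [uIcc_of_le h] at hx
      exact cut_one hb hx.1
  unfold theta
  rw [e, e2]; ring

lemma theta_le {b r : ℝ} (hb : 0 < b) (h : 0 ≤ r) : theta b r - r ≤ 2 * b := by
  have := theta_anti (b := b) h
  simp only [theta_const hb hb.le] at this
  linarith

lemma le_theta {b r : ℝ} (hb : 0 < b) : r ≤ theta b r := by
  rcases le_total r (2 * b) with h | h
  · exact h.trans (theta_ge hb r)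
  · have := theta_id hb h
    have := theta_ge hb (2 * b)
    linarith

section stepC
variable {β : ℝ → ℝ} {c η α b Q : ℝ}

lemma lower_energy (hβ : ContDiff ℝ 2 β) (hc : 0 < c) (hβc : ∀ r, c ≤ β r * (1 - β r))
    (hβα : ∀ r, 1 / 2 - η ≤ r → β r = α) (hη : 0 < η) (hb : 0 < b)
    (hQ : ∀ G, IsC1K G → energyExpr β G ≤ Q) (T : ℝ) (hT : 2 * b ≤ T) :
    ∫ r in (2 * b)..T, (deriv β r) ^ 2 / (4 * (β r * (1 - β r))) ≤ Q := by
  have hpos : ∀ r, 0 < β r * (1 - β r) := fun r => hc.trans_le (hβc r)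
  have hd1 : ContDiff ℝ 1 (deriv β) := by
    rw [show (2 : WithTop ℕ∞) = 1 + 1 by norm_num, contDiff_succ_iff_deriv] at hβ
    exact hβ.2.2
  have hβ1 : ContDiff ℝ 1 β := hβ.of_le (by norm_num)
  have hz : ∀ r, 1 / 2 - η < r → deriv β r = 0 := fun r hr => by
    have : β =ᶠ[nhds r] fun _ => α := by
      filter_upwards [lt_mem_nhds hr] with x hx
      exact hβα x hx.le
    rw [this.deriv_eq]; simp
  set G : ℝ → ℝ := fun r => cut b r * deriv β r / (2 * (β r * (1 - β r))) with hGdef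
  have hsub : tsupport G ⊆ Icc b (1 / 2) := by
    apply closure_minimal _ isClosed_Icc
    intro r hr
    by_contra h
    apply hr
    rw [mem_Icc, not_and_or, not_le, not_le] at h
    rcases h with h | h
    · simp [hGdef, cut_zero hb h.le]
    · simp [hGdef, hz r (by linarith)]
  have hG : IsC1K G := by
    refine ⟨?_, ?_, ?_⟩
    · refine ContDiff.div ?_ ?_ fun r => ?_
      · exact ((cut_contDiff b).of_le (by norm_num)).mul hd1
      · exact contDiff_const.mul (hβ1.mul (contDiff_const.sub hβ1))
      · have := hpos r; positivity
    · exact isCompact_Icc.of_isClosed_subset (isClosed_tsupport G) hsub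
    · intro r hr
      exact hb.trans_le (hsub hr).1
  obtain ⟨i1, e1⟩ := energyExpr_smooth hβ1 hG
  have h2 := hQ G hG
  rw [e1] at h2
  refine le_trans ?_ h2
  have hpt : ∀ r, G r * deriv β r - (β r * (1 - β r)) * G r ^ 2 =
      (2 * cut b r - cut b r ^ 2) * ((deriv β r) ^ 2 / (4 * (β r * (1 - β r)))) := by
    intro r
    simp only [hGdef]
    have := (hpos r).ne'
    generalize β r * (1 - β r) = s at *
    field_simp
    ring
  rw [intervalIntegral.integral_of_le hT]
  have h0 : ∀ r, 0 ≤ (deriv β r) ^ 2 / (4 * (β r * (1 - β r))) := fun r => by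
    have := hpos r; positivity
  refine le_trans (le_of_eq ?_) (setIntegral_le_integral (s := Ioc (2 * b) T) i1
    (Eventually.of_forall fun r => ?_))
  · refine setIntegral_congr_fun measurableSet_Ioc fun r hr => ?_
    rw [hpt, cut_one hb hr.1.le]; ring
  · simp only [Pi.zero_apply]
    rw [hpt]
    refine mul_nonneg ?_ (h0 r)
    nlinarith [cut_nonneg b r, cut_le_one b r]

lemma comp_energy (hβ : ContDiff ℝ 2 β) (hc : 0 < c) (hβc : ∀ r, c ≤ β r * (1 - β r))
    (hβα : ∀ r, 1 / 2 - η ≤ r → β r = α) (hη : 0 < η) (hb : 0 < b)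
    (hQ : ∀ G, IsC1K G → energyExpr β G ≤ Q) {G : ℝ → ℝ} (hG : IsC1K G) :
    energyExpr (β ∘ theta b) G ≤ Q := by
  have hpos : ∀ r, 0 < β r * (1 - β r) := fun r => hc.trans_le (hβc r)
  have hβ1 : ContDiff ℝ 1 β := hβ.of_le (by norm_num)
  have hd1 : Continuous (deriv β) := hβ1.continuous_deriv (by norm_num)
  have hz : ∀ r, 1 / 2 - η < r → deriv β r = 0 := fun r hr => by
    have : β =ᶠ[nhds r] fun _ => α := by
      filter_upwards [lt_mem_nhds hr] with x hx
      exact hβα x hx.le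
    rw [this.deriv_eq]; simp
  have hw : ContDiff ℝ 1 (β ∘ theta b) := hβ1.comp ((theta_contDiff b).of_le (by norm_num))
  obtain ⟨i1, e1⟩ := energyExpr_smooth hw hG
  have hdw : ∀ r, deriv (β ∘ theta b) r = deriv β (theta b r) * cut b r := fun r =>
    ((hβ1.differentiable (by norm_num) (theta b r)).hasDerivAt.comp r (theta_hasDeriv b r)).deriv
  set f : ℝ → ℝ := fun r => (deriv β r) ^ 2 / (4 * (β r * (1 - β r))) with hf
  have hfc : Continuous f := by
    refine (hd1.pow 2).div (continuous_const.mul (hβ.continuous.mul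
      (continuous_const.sub hβ.continuous))) fun r => ?_
    have := hpos r; positivity
  have hf0 : ∀ r, 0 ≤ f r := fun r => by
    have := hpos r; simp only [hf]; positivity
  have hθc : Continuous (theta b) := (theta_contDiff b).continuous
  have hkc : Continuous (fun r => (f ∘ theta b) r * cut b r) :=
    (hfc.comp hθc).mul (cut_contDiff b).continuous
  have hzero : ∀ r, r ∉ Ioc (0:ℝ) 1 → (f ∘ theta b) r * cut b r = 0 := by
    intro r hr
    rw [mem_Ioc, not_and_or, not_lt, not_le] at hr
    rcases hr with hr | hr
    · rw [cut_zero hb (by linarith)]; ring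
    · have h := le_theta (r := r) hb
      simp [hf, hz (theta b r) (by linarith)]
  have hki : Integrable (fun r => (f ∘ theta b) r * cut b r) := by
    refine hkc.integrable_of_hasCompactSupport ?_
    refine HasCompactSupport.intro (K := Icc (0:ℝ) 1) isCompact_Icc fun r hr => hzero r fun h => hr ⟨h.1.le, h.2⟩
  have h3 : energyExpr (β ∘ theta b) G ≤ ∫ r, (f ∘ theta b) r * cut b r := by
    rw [e1]
    refine integral_mono i1 hki fun r => ?_
    simp only [hdw, Function.comp]
    have hp := hpos (theta b r)
    have h1 : deriv β (theta b r) ^ 2 = 4 * (β (theta b r) * (1 - β (theta b r))) * f (theta b r) := by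
      have hne : 4 * (β (theta b r) * (1 - β (theta b r))) ≠ 0 := by positivity
      simp only [hf]
      rw [mul_div_cancel₀ _ hne]
    have hf0' := hf0 (theta b r)
    generalize β (theta b r) * (1 - β (theta b r)) = s at *
    generalize f (theta b r) = F at *
    generalize deriv β (theta b r) = d at *
    generalize G r = y
    have hχ0 := cut_nonneg b r
    have hχ1 := cut_le_one b r
    generalize cut b r = χ at *
    have h2 : y * (d * χ) - s * y ^ 2 ≤ F * χ ^ 2 := by
      have : 0 ≤ s * (F * χ ^ 2 - (y * (d * χ) - s * y ^ 2)) := by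
        nlinarith [sq_nonneg (s * y - d * χ / 2)]
      have := nonneg_of_mul_nonneg_right this hp
      linarith
    have : F * χ ^ 2 ≤ F * χ := mul_le_mul_of_nonneg_left (by nlinarith) hf0'
    linarith
  refine h3.trans ?_
  rw [← setIntegral_eq_integral_of_forall_compl_eq_zero hzero,
    ← intervalIntegral.integral_of_le zero_le_one,
    intervalIntegral.integral_comp_mul_deriv (fun x _ => theta_hasDeriv b x)
      (cut_contDiff b).continuous.continuousOn hfc, theta_const hb hb.le]
  exact lower_energy hβ hc hβc hβα hη hb hQ _ (theta_ge hb 1)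

end stepC

lemma key_approx {α : ℝ} (hα0 : 0 < α) (hα1 : α < 1) {M : ℝ → ℝ} (hM : Measurable M)
    (hM1 : ∀ r, M r ∈ Icc (0:ℝ) 1) (hMα : ∀ r, r ∉ Ioc (0:ℝ) (1 / 2) → M r = α)
    (hQ : energy M ≠ ⊤) {ε : ℝ} (hε : 0 < ε) :
    ∃ w : ℝ → ℝ, ContDiff ℝ 2 w ∧
      (∃ e : ℝ, 0 < e ∧ ∀ r, e ≤ w r ∧ w r ≤ 1 - e) ∧
      (HasCompactSupport (deriv w) ∧ tsupport (deriv w) ⊆ Set.Ioo 0 (1/2)) ∧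
      (∀ r : ℝ, 1/2 ≤ r → w r = α) ∧ energy w ≤ energy M ∧
      ∫ r in Ioc (0:ℝ) 1, |w r - M r| ≤ ε := by
  obtain ⟨δ, hδ, hδM⟩ := translate_L1 (α := α) hM hM1
    (fun r hr => hMα r fun h => hr ⟨h.1, by linarith [h.2]⟩) (ε := ε / 3) (by positivity)
  obtain ⟨η, hη, hηδ, hη8⟩ : ∃ η : ℝ, 0 < η ∧ 4 * η ≤ δ ∧ η ≤ 1 / 8 :=
    ⟨min (δ / 4) (1 / 8), by positivity, by linarith [min_le_left (δ / 4) (1 / 8)], min_le_right _ _⟩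
  let φ : ContDiffBump (-2 * η) := ⟨η / 2, η, by positivity, by linarith⟩
  set g : ℝ → ℝ := φ.normed volume with hgdef
  have hgcd : ContDiff ℝ 2 g := φ.contDiff_normed (n := 2)
  have hgcs : HasCompactSupport g := φ.hasCompactSupport_normed
  have hgc : Continuous g := hgcd.continuous
  have hg : Integrable g := hgc.integrable_of_hasCompactSupport hgcs
  have hg0 : ∀ u, 0 ≤ g u := φ.nonneg_normed
  have hgi : ∫ u, g u = 1 := φ.integral_normed
  have hgs : ∀ u, g u ≠ 0 → -3 * η < u ∧ u < -η := fun u hu => by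
    have h : u ∈ Function.support g := hu
    rw [hgdef, φ.support_normed_eq, Metric.mem_ball, Real.dist_eq, abs_lt] at h
    change -η < _ ∧ _ < η at h
    constructor <;> linarith [h.1, h.2]
  set γ := moll g M with hγ
  have hγ2 : ContDiff ℝ 2 γ := moll_contDiff hM hM1 hgcd hgcs
  have hγm : ∀ x, γ x ∈ Icc (0:ℝ) 1 := moll_mem hM hM1 hg hg0 hgi
  have hγα : ∀ r, 1 / 2 - η ≤ r → γ r = α := fun r hr => by
    have : γ r = ∫ u, g u * α := by
      rw [hγ]; unfold moll
      congr 1; ext u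
      by_cases hu : g u = 0
      · simp [hu]
      · rw [hMα (r - u)]
        intro h
        linarith [(hgs u hu).2, h.2]
    rw [this, integral_mul_const, hgi, one_mul]
  have hγE : ∀ G, IsC1K G → energyExpr γ G ≤ (energy M).toReal := fun G hG =>
    moll_energy hM hM1 hgc hgcs hg0 hgi (fun u hu => by
      by_contra h; linarith [(hgs u h).2]) hγ2.continuous hQ hG
  have hγL : ∫ x in Ioc (0:ℝ) 1, |γ x - M x| ≤ ε / 3 :=
    moll_L1 hM hM1 hg hγ2.continuous.measurable hg0 hgi (δ := δ) (fun u hu => by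
      by_contra h
      have := hgs u h
      rw [abs_of_neg (by linarith)] at hu
      linarith) hδM
  obtain ⟨e, he, heε, he1⟩ : ∃ e : ℝ, 0 < e ∧ e ≤ ε / 3 ∧ e ≤ 1 / 2 :=
    ⟨min (ε / 3) (1 / 2), by positivity, min_le_left _ _, min_le_right _ _⟩
  set β : ℝ → ℝ := fun r => (1 - e) * γ r + e * α with hβ
  have hβ2 : ContDiff ℝ 2 β := (contDiff_const.mul hγ2).add contDiff_const
  obtain ⟨c, hc, hc1, hc2⟩ : ∃ c : ℝ, 0 < c ∧ c ≤ e * α ∧ c ≤ e * (1 - α) := by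
    have : 0 < 1 - α := by linarith
    exact ⟨min (e * α) (e * (1 - α)), by positivity, min_le_left _ _, min_le_right _ _⟩
  have hβb : ∀ r, c ≤ β r ∧ β r ≤ 1 - c := fun r => by
    have h := hγm r
    simp only [hβ]
    constructor
    · have := mul_nonneg (by linarith : 0 ≤ 1 - e) h.1
      linarith
    · have := mul_le_mul_of_nonneg_left h.2 (by linarith : 0 ≤ 1 - e)
      linarith
  have hβσ : ∀ r, c ^ 2 ≤ β r * (1 - β r) := fun r => by
    have h := hβb r
    nlinarith [mul_le_mul h.1 (by linarith [h.2] : c ≤ 1 - β r) hc.le (by linarith)]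
  have hβα : ∀ r, 1 / 2 - η ≤ r → β r = α := fun r hr => by
    simp only [hβ, hγα r hr]; ring
  have hβE : ∀ G, IsC1K G → energyExpr β G ≤ (energy M).toReal := fun G hG =>
    mix_energy hα0.le hα1.le he.le (by linarith) (hγ2.of_le (by norm_num)) hG
      ENNReal.toReal_nonneg (hγE G hG)
  have hβγ : ∀ r, |β r - γ r| ≤ ε / 3 := fun r => by
    have h := hγm r
    have : β r - γ r = e * (α - γ r) := by simp only [hβ]; ring
    rw [this, abs_mul, abs_of_pos he]
    have : |α - γ r| ≤ 1 := by rw [abs_le]; constructor <;> linarith [h.1, h.2]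
    nlinarith
  have huc := isCompact_Icc.uniformContinuousOn_of_continuous
    (hβ2.continuous.continuousOn (s := Icc (0:ℝ) 3))
  obtain ⟨d, hd, hdβ⟩ := Metric.uniformContinuousOn_iff.1 huc (ε / 3) (by positivity)
  obtain ⟨b, hb, hbd, hb8⟩ : ∃ b : ℝ, 0 < b ∧ 4 * b ≤ d ∧ b ≤ 1 / 8 :=
    ⟨min (d / 4) (1 / 8), by positivity, by linarith [min_le_left (d / 4) (1 / 8)], min_le_right _ _⟩
  set w := β ∘ theta b with hw
  have hw2 : ContDiff ℝ 2 w := hβ2.comp (theta_contDiff b)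
  have hwα : ∀ r, 1 / 2 - η ≤ r → w r = α := fun r hr => hβα _ (hr.trans (le_theta hb))
  have hwb : ∀ r, w r ∈ Icc (0:ℝ) 1 := fun r =>
    ⟨hc.le.trans (hβb _).1, (hβb _).2.trans (by linarith)⟩
  have hsub : tsupport (deriv w) ⊆ Icc b (1 / 2 - η) := by
    apply closure_minimal _ isClosed_Icc
    intro r hr
    by_contra h
    apply hr
    rw [mem_Icc, not_and_or, not_le, not_le] at h
    rcases h with h | h
    · have : w =ᶠ[nhds r] fun _ => β (2 * b) := by
        filter_upwards [gt_mem_nhds h] with x hx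
        simp only [hw, Function.comp, theta_const hb hx.le]
      rw [this.deriv_eq]; simp
    · have : w =ᶠ[nhds r] fun _ => α := by
        filter_upwards [lt_mem_nhds h] with x hx
        exact hwα x hx.le
      rw [this.deriv_eq]; simp
  refine ⟨w, hw2, ⟨c, hc, fun r => hβb _⟩, ⟨?_, ?_⟩, fun r hr => hwα r (by linarith), ?_, ?_⟩
  · exact isCompact_Icc.of_isClosed_subset (isClosed_tsupport _) hsub
  · intro r hr
    have := hsub hr
    exact ⟨by linarith [this.1], by linarith [this.2]⟩
  · exact energy_le hQ fun G hG =>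
      comp_energy hβ2 (pow_pos hc 2) hβσ hβα hη hb hβE hG
  · have hi := abs_diff_integrableOn hγ2.continuous.measurable hγm hM hM1
    calc ∫ r in Ioc (0:ℝ) 1, |w r - M r| ≤ ∫ r in Ioc (0:ℝ) 1, (|γ r - M r| + 2 * ε / 3) := by
          refine setIntegral_mono_on
            (abs_diff_integrableOn hw2.continuous.measurable hwb hM hM1)
            (hi.add (integrable_const _)) measurableSet_Ioc fun r hr => ?_
          have h1 := theta_le hb hr.1.le
          have h2 := le_theta (r := r) hb
          have h3 := hdβ (theta b r) ⟨hr.1.le.trans h2, by linarith [hr.2]⟩ r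
            ⟨hr.1.le, by linarith [hr.2]⟩ (by
              rw [Real.dist_eq, abs_of_nonneg (by linarith)]; linarith)
          rw [Real.dist_eq] at h3
          have h4 := hβγ r
          have : w r - M r = (β (theta b r) - β r) + (β r - γ r) + (γ r - M r) := by
            simp only [hw, Function.comp]; ring
          rw [this]
          have := abs_add_three (β (theta b r) - β r) (β r - γ r) (γ r - M r)
          linarith
      _ = (∫ r in Ioc (0:ℝ) 1, |γ r - M r|) + 2 * ε / 3 := by
          rw [integral_add hi (integrable_const _)]; simp
      _ ≤ ε := by linarith

/-- Any density with finite energy which equals `α` a.e. on `(1/2,∞)` can be approximated,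
in the vague topology and in energy, by `C²` densities bounded away from `0` and `1`,
with derivative compactly supported in `(0,1/2)` and equal to `α` on `[1/2,∞)`. -/
theorem stmt6 (α : ℝ) (hα0 : 0 < α) (hα1 : α < 1)
    (m : ℝ → ℝ) (hmeas : Measurable m)
    (hm01 : ∀ r ∈ Set.Ioi (0:ℝ), m r ∈ Set.Icc (0:ℝ) 1)
    (hma : ∀ᵐ r ∂(volume.restrict (Set.Ioi (1/2 : ℝ))), m r = α)
    (hQ : energy m ≠ ⊤) :
    ∃ γs : ℕ → ℝ → ℝ,
      (∀ n, ContDiff ℝ 2 (γs n)) ∧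
      (∀ n, ∃ ε : ℝ, 0 < ε ∧ ∀ r, ε ≤ γs n r ∧ γs n r ≤ 1 - ε) ∧
      (∀ n, HasCompactSupport (deriv (γs n)) ∧
        tsupport (deriv (γs n)) ⊆ Set.Ioo 0 (1/2)) ∧
      (∀ n, ∀ r : ℝ, 1/2 ≤ r → γs n r = α) ∧
      (∀ G : ℝ → ℝ, Continuous G → HasCompactSupport G → tsupport G ⊆ Set.Ioi 0 →
        Tendsto (fun n => ∫ r in Set.Ioi (0:ℝ), G r * γs n r) atTop
          (nhds (∫ r in Set.Ioi (0:ℝ), G r * m r))) ∧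
      Tendsto (fun n => energy (γs n)) atTop (nhds (energy m)) := by
  classical
  set M : ℝ → ℝ := fun r => if r ∈ Ioc (0:ℝ) (1/2) then m r else α with hMdef
  have hM : Measurable M := Measurable.ite measurableSet_Ioc hmeas measurable_const
  have hM1 : ∀ r, M r ∈ Icc (0:ℝ) 1 := fun r => by
    simp only [hMdef]
    split_ifs with h
    · exact hm01 r h.1
    · exact ⟨hα0.le, hα1.le⟩
  have hMα : ∀ r, r ∉ Ioc (0:ℝ) (1 / 2) → M r = α := fun r hr => if_neg hr
  have hae : ∀ᵐ r ∂(volume.restrict (Ioi (0:ℝ))), m r = M r := by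
    rw [ae_restrict_iff' measurableSet_Ioi] at hma ⊢
    filter_upwards [hma] with r hr h0
    by_cases h : r ≤ 1 / 2
    · simp only [hMdef]; rw [if_pos ⟨h0, h⟩]
    · rw [hr (not_le.1 h), hMα r fun h' => h h'.2]
  have hE : energy m = energy M := by
    unfold energy
    congr 1; ext G
    congr 1
    unfold energyExpr
    congr 1
    · congr 1
      refine integral_congr_ae ?_
      filter_upwards [hae] with r hr
      rw [hr]
    · refine integral_congr_ae ?_
      filter_upwards [hae] with r hr
      rw [hr]
  rw [hE] at hQ ⊢
  have hex := fun n : ℕ => key_approx hα0 hα1 hM hM1 hMα hQ (ε := 1 / ((n:ℝ) + 1)) (by positivity)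
  choose γs h1 h2 h3 h4 h5 h6 using hex
  have hγm : ∀ n, Measurable (γs n) := fun n => (h1 n).continuous.measurable
  have hγ1 : ∀ n r, γs n r ∈ Icc (0:ℝ) 1 := fun n r => by
    obtain ⟨e, he, h⟩ := h2 n
    exact ⟨he.le.trans (h r).1, (h r).2.trans (by linarith)⟩
  have heq : ∀ n r, 1 < r → γs n r = M r := fun n r hr => by
    rw [h4 n r (by linarith), hMα r fun h => by linarith [h.2]]
  have hlim : Tendsto (fun n => ∫ r in Ioc (0:ℝ) 1, |γs n r - M r|) atTop (nhds 0) :=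
    squeeze_zero (fun n => integral_nonneg fun r => abs_nonneg _) h6
      tendsto_one_div_add_atTop_nhds_zero_nat
  refine ⟨γs, h1, h2, h3, h4, fun G hG hGc _ => ?_,
    tendsto_energy hM hM1 hγm hγ1 heq hlim h5⟩
  have hGm : ∫ r in Ioi (0:ℝ), G r * m r = ∫ r in Ioi (0:ℝ), G r * M r := by
    refine integral_congr_ae ?_
    filter_upwards [hae] with r hr
    rw [hr]
  rw [hGm]
  exact (tendsto_of_L1 hM hM1 hγm hγ1 heq hlim hG hGc).1
end
end
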